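/- For every real α with 0 < α ≤ 1/2 there exist a constant C > 0 and an integer K such that for all nonnegative integers k₀, k₁ with k := k₀ + k₁ ≥ K and every integer n ≥ 4·k⁶, there exists an (n, k₀, k₁, α, 1)-mapping family of size at most (1/α)^k · k^{C·k^{5/6}} · log n. -/

import Mathlib

open Finset

/-- An `(n,k₀,k₁,α,β)`-mapping family: every function maps exactly `⌈α·n⌉` elements
to `1`, and for all disjoint `S₀, S₁ ⊆ [n]` with `|S₀| = k₀`, `|S₁| = k₁` some
function maps all of `S₀` to `0` and exactly `⌈β·k₁⌉` elements of `S₁` to `1`. -/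
def IsMappingFamily (n k₀ k₁ : ℕ) (α β : ℝ) (F : Finset (Fin n → Fin 2)) : Prop :=
  (∀ f ∈ F, (Finset.univ.filter fun x => f x = 1).card = ⌈α * (n : ℝ)⌉₊) ∧
  ∀ S₀ S₁ : Finset (Fin n), Disjoint S₀ S₁ → S₀.card = k₀ → S₁.card = k₁ →
    ∃ f ∈ F, (∀ x ∈ S₀, f x = 0) ∧
      (S₁.filter fun x => f x = 1).card = ⌈β * (k₁ : ℝ)⌉₊

open Classical in
lemma mf_cover {X Y : Type*} (Ω : Finset X) (T : Finset Y) (R : X → Y → Prop) (p : ℝ)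
    (hΩ : Ω.Nonempty) (hp1 : p ≤ 1)
    (h : ∀ y ∈ T, p * (Ω.card : ℝ) ≤ ((Ω.filter fun x => R x y).card : ℝ)) (t : ℕ) :
    ∃ F : Finset X, F ⊆ Ω ∧ F.card ≤ t ∧
      ((T.filter fun y => ∀ x ∈ F, ¬ R x y).card : ℝ) ≤ T.card * (1 - p) ^ t := by
  induction t with
  | zero => exact ⟨∅, by simp, by simp, by simp⟩
  | succ t ih =>
    obtain ⟨F, hF, hc, hu⟩ := ih
    set U := T.filter fun y => ∀ x ∈ F, ¬ R x y with hU
    have hsum : ∑ x ∈ Ω, (p * (U.card : ℝ)) ≤ ∑ x ∈ Ω, ((U.filter fun y => R x y).card : ℝ) := by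
      have e : ∑ x ∈ Ω, ((U.filter fun y => R x y).card : ℝ)
          = ∑ y ∈ U, ((Ω.filter fun x => R x y).card : ℝ) := by
        have := Finset.sum_card_bipartiteAbove_eq_sum_card_bipartiteBelow (s := Ω) (t := U) R
        unfold Finset.bipartiteAbove Finset.bipartiteBelow at this
        exact_mod_cast this
      rw [e]
      calc ∑ x ∈ Ω, (p * (U.card : ℝ)) = ∑ y ∈ U, (p * (Ω.card : ℝ)) := by
            simp; ring
        _ ≤ _ := Finset.sum_le_sum fun y hy => h y (Finset.mem_filter.1 hy).1
    obtain ⟨x, hx, hxle⟩ := Finset.exists_le_of_sum_le hΩ hsum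
    refine ⟨insert x F, Finset.insert_subset hx hF, (Finset.card_insert_le _ _).trans (by omega), ?_⟩
    have e2 : (T.filter fun y => ∀ z ∈ insert x F, ¬ R z y) = U.filter fun y => ¬ R x y := by
      ext y; simp only [hU, Finset.mem_filter, Finset.mem_insert]; grind
    have e3 : ((U.filter fun y => R x y).card : ℝ) + ((U.filter fun y => ¬ R x y).card : ℝ)
        = U.card := by
      exact_mod_cast Finset.card_filter_add_card_filter_not (s := U) (fun y => R x y)
    rw [e2, pow_succ, ← mul_assoc]
    have : (U.card : ℝ) * (1 - p) ≤ T.card * (1 - p) ^ t * (1 - p) :=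
      mul_le_mul_of_nonneg_right hu (by linarith)
    linarith

lemma mf_choose (M L : ℕ) (q : ℝ) (hq : 0 ≤ q) (a b : ℕ)
    (h1 : q * ((M + L + a + b : ℕ) : ℝ) ≤ M) (h2 : q * ((M + L + a + b : ℕ) : ℝ) ≤ L) :
    q ^ (a + b) * ((M + L + a + b).choose (M + a) : ℝ) ≤ ((M + L).choose M : ℝ) := by
  induction a with
  | zero =>
    induction b with
    | zero => simp
    | succ b ih =>
      have hm : q * ((M + L + 0 + b : ℕ) : ℝ) ≤ q * ((M + L + 0 + (b + 1) : ℕ) : ℝ) :=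
        mul_le_mul_of_nonneg_left (by push_cast; linarith) hq
      have ih' := ih (hm.trans h1) (hm.trans h2)
      refine le_trans ?_ ih'
      have key := Nat.add_one_mul_choose_eq (M + L + b) (L + b)
      have s1 : (M + L + b + 1).choose (L + b + 1) = (M + L + 0 + (b + 1)).choose (M + 0) := by
        apply Nat.choose_symm_of_eq_add; omega
      have s2 : (M + L + b).choose (L + b) = (M + L + 0 + b).choose (M + 0) := by
        apply Nat.choose_symm_of_eq_add; omega
      rw [s1, s2] at key
      have key' : ((M + L + b + 1 : ℕ) : ℝ) * ((M + L + 0 + b).choose (M + 0) : ℝ)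
        = ((M + L + 0 + (b + 1)).choose (M + 0) : ℝ) * ((L + b + 1 : ℕ) : ℝ) := by exact_mod_cast key
      have hle : q * ((M + L + 0 + (b + 1)).choose (M + 0) : ℝ)
          ≤ ((M + L + 0 + b).choose (M + 0) : ℝ) := by
        have hpos : (0 : ℝ) < ((M + L + b + 1 : ℕ) : ℝ) := by positivity
        refine le_of_mul_le_mul_left ?_ hpos
        rw [key']
        have : q * ((M + L + b + 1 : ℕ) : ℝ) ≤ ((L + b + 1 : ℕ) : ℝ) := by
          have : ((M + L + 0 + (b + 1) : ℕ) : ℝ) = ((M + L + b + 1 : ℕ) : ℝ) := by push_cast; ring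
          rw [this] at h2; push_cast at h2 ⊢; linarith [(Nat.cast_nonneg b : (0:ℝ) ≤ b)]
        nlinarith [(Nat.cast_nonneg ((M + L + 0 + (b + 1)).choose (M + 0)) : (0:ℝ) ≤ _)]
      rw [show 0 + (b + 1) = (0 + b) + 1 by ring, pow_succ, mul_assoc]
      exact mul_le_mul_of_nonneg_left hle (by positivity)
  | succ a ih =>
      have hm : q * ((M + L + a + b : ℕ) : ℝ) ≤ q * ((M + L + (a + 1) + b : ℕ) : ℝ) :=
        mul_le_mul_of_nonneg_left (by push_cast; linarith) hq
      have ih' := ih (hm.trans h1) (hm.trans h2)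
      refine le_trans ?_ ih'
      have key := Nat.add_one_mul_choose_eq (M + L + a + b) (M + a)
      rw [show (M + L + a + b) + 1 = M + L + (a + 1) + b by omega,
        show (M + a) + 1 = M + (a + 1) by omega] at key
      have key' : ((M + L + (a + 1) + b : ℕ) : ℝ) * ((M + L + a + b).choose (M + a) : ℝ)
        = ((M + L + (a + 1) + b).choose (M + (a + 1)) : ℝ) * ((M + (a + 1) : ℕ) : ℝ) := by
        exact_mod_cast key
      have hle : q * ((M + L + (a + 1) + b).choose (M + (a + 1)) : ℝ)
          ≤ ((M + L + a + b).choose (M + a) : ℝ) := by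
        have hpos : (0 : ℝ) < ((M + L + (a + 1) + b : ℕ) : ℝ) := by
          have : 0 < M + L + (a + 1) + b := by omega
          exact_mod_cast this
        refine le_of_mul_le_mul_left ?_ hpos
        rw [key']
        have : q * ((M + L + (a + 1) + b : ℕ) : ℝ) ≤ ((M + (a + 1) : ℕ) : ℝ) := by
          refine h1.trans ?_
          push_cast; linarith [(Nat.cast_nonneg a : (0:ℝ) ≤ a)]
        nlinarith [(Nat.cast_nonneg ((M + L + (a + 1) + b).choose (M + (a + 1))) : (0:ℝ) ≤ _)]
      rw [show a + 1 + b = (a + b) + 1 by ring, pow_succ, mul_assoc]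
      exact mul_le_mul_of_nonneg_left hle (by positivity)

lemma mf_count (n m k₀ k₁ : ℕ) (hm : k₁ ≤ m) (S₀ S₁ : Finset (Fin n)) (hd : Disjoint S₀ S₁)
    (h0 : S₀.card = k₀) (h1 : S₁.card = k₁) :
    (n - (k₀ + k₁)).choose (m - k₁) ≤
      ((Finset.powersetCard m (Finset.univ : Finset (Fin n))).filter
        fun A => Disjoint S₀ A ∧ S₁ ⊆ A).card := by
  have hc : (Finset.powersetCard (m - k₁) ((S₀ ∪ S₁)ᶜ)).card = (n - (k₀ + k₁)).choose (m - k₁) := by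
    rw [Finset.card_powersetCard, Finset.card_compl, Finset.card_union_of_disjoint hd, h0, h1]
    simp
  rw [← hc]
  have hdis : ∀ A ∈ Finset.powersetCard (m - k₁) ((S₀ ∪ S₁)ᶜ), Disjoint A S₀ ∧ Disjoint A S₁ := by
    intro A hA
    have hA := (Finset.mem_powersetCard.1 hA).1
    have : Disjoint A (S₀ ∪ S₁) := by
      exact Finset.subset_compl_iff_disjoint_right.1 hA
    exact Finset.disjoint_union_right.1 this
  refine Finset.card_le_card_of_injOn (fun A => A ∪ S₁) ?_ ?_
  · intro A hA
    obtain ⟨d0, d1⟩ := hdis A hA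
    have hA2 := (Finset.mem_powersetCard.1 hA).2
    simp only [Finset.coe_filter, Set.mem_ofPred_eq, Finset.mem_powersetCard]
    refine ⟨⟨Finset.subset_univ _, ?_⟩, ?_, Finset.subset_union_right⟩
    · rw [Finset.card_union_of_disjoint d1]; omega
    · exact Finset.disjoint_union_right.2 ⟨d0.symm, hd⟩
  · intro A hA B hB hAB
    obtain ⟨_, d1⟩ := hdis A hA
    obtain ⟨_, d2⟩ := hdis B hB
    have := congrArg (fun Z => Z \ S₁) hAB
    simpa [Finset.union_sdiff_right, Finset.sdiff_eq_self_of_disjoint d1,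
      Finset.sdiff_eq_self_of_disjoint d2] using this

set_option maxHeartbeats 1000000 in
lemma mf_prob (α : ℝ) (hα0 : 0 < α) (hα1 : α ≤ 1 / 2) (n k₀ k₁ : ℕ)
    (hK : 1 / α ≤ ((k₀ + k₁ : ℕ) : ℝ)) (hn : 4 * (k₀ + k₁) ^ 6 ≤ n) :
    k₁ ≤ ⌈α * (n : ℝ)⌉₊ ∧ ⌈α * (n : ℝ)⌉₊ ≤ n ∧
    α ^ (k₀ + k₁) / 2 * (n.choose ⌈α * (n : ℝ)⌉₊ : ℝ)
      ≤ ((n - (k₀ + k₁)).choose (⌈α * (n : ℝ)⌉₊ - k₁) : ℝ) := by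
  set k := k₀ + k₁ with hk
  have hk1 : (1 : ℝ) ≤ (k : ℝ) := by
    refine le_trans ?_ hK
    rw [le_div_iff₀ hα0]; linarith
  have hαk : 1 ≤ α * k := by
    rw [div_le_iff₀ hα0] at hK; linarith
  have hnR : 4 * (k : ℝ) ^ 6 ≤ n := by exact_mod_cast hn
  have hαn : 4 * (k : ℝ) ^ 5 ≤ α * n := by
    calc 4 * (k : ℝ) ^ 5 ≤ 4 * (k : ℝ) ^ 5 * (α * k) := le_mul_of_one_le_right (by positivity) hαk
      _ = α * (4 * (k : ℝ) ^ 6) := by ring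
      _ ≤ _ := mul_le_mul_of_nonneg_left hnR hα0.le
  have hk52 : (k : ℝ) ^ 2 ≤ (k : ℝ) ^ 5 := pow_le_pow_right₀ hk1 (by norm_num)
  have hkk2 : (k : ℝ) ≤ (k : ℝ) ^ 2 := by nlinarith
  have hnpos : (0 : ℝ) < n := by
    have : (0 : ℝ) < (k : ℝ) ^ 6 := by positivity
    linarith
  set m := ⌈α * (n : ℝ)⌉₊ with hm
  have hm1 : α * n ≤ m := Nat.le_ceil _
  have hm2 : (m : ℝ) < α * n + 1 := Nat.ceil_lt_add_one (by positivity)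
  have hkR : (k : ℝ) = k₀ + k₁ := by rw [hk]; push_cast; ring
  have hk0' : (0 : ℝ) ≤ k₀ := Nat.cast_nonneg _
  have hk1' : (0 : ℝ) ≤ k₁ := Nat.cast_nonneg _
  have hα2 : α * n ≤ n / 2 := by nlinarith
  have hk1m : k₁ ≤ m := by
    have : (k₁ : ℝ) ≤ m := by linarith
    exact_mod_cast this
  have hmk : m + k₀ ≤ n := by
    have : (m : ℝ) + k₀ ≤ n := by linarith
    exact_mod_cast this
  refine ⟨hk1m, by omega, ?_⟩
  obtain ⟨M, hM⟩ := Nat.exists_eq_add_of_le' hk1m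
  obtain ⟨L, hL⟩ := Nat.exists_eq_add_of_le' hmk
  set q : ℝ := α - (k + 1) / n with hq
  have hqn : q * n = α * n - k - 1 := by rw [hq]; field_simp; ring
  have hq0 : 0 ≤ q := by
    have : 0 ≤ q * n := by rw [hqn]; linarith
    exact nonneg_of_mul_nonneg_left this hnpos
  have hnN : M + L + k₁ + k₀ = n := by omega
  have hMR : (m : ℝ) = M + k₁ := by rw [hM]; push_cast; ring
  have hLR : (n : ℝ) = L + (m + k₀) := by exact_mod_cast hL
  have := mf_choose M L q hq0 k₁ k₀ (by rw [hnN, hqn]; linarith) (by rw [hnN, hqn]; linarith)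
  rw [hnN, ← hM] at this
  have e1 : n - k = M + L := by omega
  have e2 : m - k₁ = M := by omega
  rw [e1, e2]
  refine le_trans ?_ this
  refine mul_le_mul_of_nonneg_right ?_ (by positivity)
  rw [show k₁ + k₀ = k by omega]
  have hb : 1 + (k : ℝ) * (-((k + 1) / (α * n))) ≤ (1 + -((k + 1) / (α * n))) ^ k := by
    apply one_add_mul_le_pow
    have : ((k : ℝ) + 1) / (α * n) ≤ 1 := by
      rw [div_le_one (by positivity)]; linarith
    linarith
  have hb2 : (1 : ℝ) / 2 ≤ 1 + (k : ℝ) * (-((k + 1) / (α * n))) := by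
    have : (k : ℝ) * ((k + 1) / (α * n)) ≤ 1 / 2 := by
      rw [← mul_div_assoc, div_le_iff₀ (by positivity)]
      nlinarith
    linarith
  have hqe : q = α * (1 + -((k + 1) / (α * n))) := by
    rw [hq]; field_simp; ring
  rw [hqe, mul_pow]
  have : (0 : ℝ) < α ^ k := by positivity
  nlinarith

/-- For every `0 < α ≤ 1/2` there are `C > 0` and `K` such that for all `k₀, k₁` with
`k := k₀ + k₁ ≥ K` and all `n ≥ 4·k⁶`, there is an `(n,k₀,k₁,α,1)`-mapping family of
size at most `(1/α)^k · k^{C·k^{5/6}} · log n`. -/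
theorem mapping_family_general (α : ℝ) (hα0 : 0 < α) (hα1 : α ≤ 1 / 2) :
    ∃ C : ℝ, 0 < C ∧ ∃ K : ℕ, ∀ k₀ k₁ : ℕ, K ≤ k₀ + k₁ →
      ∀ n : ℕ, 4 * (k₀ + k₁) ^ 6 ≤ n →
      ∃ F : Finset (Fin n → Fin 2),
        IsMappingFamily n k₀ k₁ α 1 F ∧
          (F.card : ℝ) ≤
            (1 / α) ^ (k₀ + k₁) *
              ((k₀ + k₁ : ℕ) : ℝ) ^
                (C * ((k₀ + k₁ : ℕ) : ℝ) ^ ((5 : ℝ) / 6)) *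
              Real.logb 2 n := by
  classical
  refine ⟨2, by norm_num, ⌈1 / α⌉₊ + 3, ?_⟩
  intro k₀ k₁ hK n hn
  have hKα : 1 / α ≤ ((k₀ + k₁ : ℕ) : ℝ) := by
    refine (Nat.le_ceil _).trans ?_
    exact_mod_cast (by omega : ⌈1 / α⌉₊ ≤ k₀ + k₁)
  obtain ⟨hk1m, hmn, hprob⟩ := mf_prob α hα0 hα1 n k₀ k₁ hKα hn
  set k := k₀ + k₁ with hk
  set m := ⌈α * (n : ℝ)⌉₊ with hm
  have hk3 : 3 ≤ k := by omega
  have hk3R : (3 : ℝ) ≤ (k : ℝ) := by exact_mod_cast hk3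
  have hn2 : 2 ≤ n := by
    have : 1 ≤ k ^ 6 := Nat.one_le_pow _ _ (by omega)
    omega
  have hnpos : (0 : ℝ) < n := by exact_mod_cast (by omega : 0 < n)
  have hn2R : (2 : ℝ) ≤ n := by exact_mod_cast hn2
  set p : ℝ := α ^ k / 2 with hp
  have hp0 : 0 < p := by positivity
  have hp1 : p ≤ 1 := by
    have : α ^ k ≤ 1 := pow_le_one₀ hα0.le (by linarith)
    rw [hp]; linarith
  set Ω := Finset.powersetCard m (Finset.univ : Finset (Fin n)) with hΩ
  have hΩc : Ω.card = n.choose m := by rw [hΩ, Finset.card_powersetCard]; simp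
  have hΩne : Ω.Nonempty := by
    rw [← Finset.card_pos, hΩc]; exact Nat.choose_pos hmn
  set T := ((Finset.powersetCard k₀ (Finset.univ : Finset (Fin n))) ×ˢ
    (Finset.powersetCard k₁ (Finset.univ : Finset (Fin n)))).filter
      (fun y => Disjoint y.1 y.2) with hT
  have hTc : (T.card : ℝ) ≤ (n : ℝ) ^ k := by
    have h1 : T.card ≤ n.choose k₀ * n.choose k₁ := by
      refine (Finset.card_filter_le _ _).trans ?_
      rw [Finset.card_product, Finset.card_powersetCard, Finset.card_powersetCard]; simp
    have h2 : n.choose k₀ * n.choose k₁ ≤ n ^ k := by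
      rw [hk, pow_add]
      exact Nat.mul_le_mul (Nat.choose_le_pow _ _) (Nat.choose_le_pow _ _)
    exact_mod_cast h1.trans h2
  set t := ⌊k * Real.log n / p⌋₊ + 1 with ht
  obtain ⟨G, hG, hGc, hGu⟩ := mf_cover Ω T (fun A y => Disjoint y.1 A ∧ y.2 ⊆ A) p hΩne hp1
    (by
      intro y hy
      rw [hT, Finset.mem_filter, Finset.mem_product, Finset.mem_powersetCard,
        Finset.mem_powersetCard] at hy
      obtain ⟨⟨⟨_, h0⟩, ⟨_, h1⟩⟩, hd⟩ := hy
      rw [hΩc]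
      refine hprob.trans ?_
      have := mf_count n m k₀ k₁ hk1m y.1 y.2 hd h0 h1
      have h' : ((n - (k₀ + k₁)).choose (m - k₁) : ℝ) ≤ _ := Nat.cast_le.2 this
      refine h'.trans (le_of_eq ?_)
      congr) t
  have hlog : 0 < Real.log n := Real.log_pos (by linarith)
  have hlt : (T.card : ℝ) * (1 - p) ^ t < 1 := by
    have h1 : (1 - p) ^ t ≤ Real.exp (-(p * t)) := by
      have : (1 - p) ≤ Real.exp (-p) := by linarith [Real.add_one_le_exp (-p)]
      calc (1 - p) ^ t ≤ (Real.exp (-p)) ^ t := pow_le_pow_left₀ (by linarith) this t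
        _ = _ := by rw [← Real.exp_nat_mul]; congr 1; ring
    have h2 : k * Real.log n < p * t := by
      have : k * Real.log n / p < t := by
        rw [ht]; push_cast; exact Nat.lt_floor_add_one _
      rw [div_lt_iff₀ hp0] at this; linarith
    have h3 : (n : ℝ) ^ k = Real.exp (k * Real.log n) := by
      rw [Real.exp_nat_mul, Real.exp_log hnpos]
    calc (T.card : ℝ) * (1 - p) ^ t ≤ Real.exp (k * Real.log n) * Real.exp (-(p * t)) := by
          rw [← h3]
          exact mul_le_mul hTc h1 (pow_nonneg (by linarith) _) (by positivity)
      _ = Real.exp (k * Real.log n - p * t) := by rw [← Real.exp_add]; congr 1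
      _ < 1 := by rw [Real.exp_lt_one_iff]; linarith
  have hcov : ∀ y ∈ T, ∃ A ∈ G, Disjoint y.1 A ∧ y.2 ⊆ A := by
    intro y hy
    by_contra hcon
    push Not at hcon
    have hmem : y ∈ T.filter fun y => ∀ x ∈ G, ¬ (Disjoint y.1 x ∧ y.2 ⊆ x) := by
      rw [Finset.mem_filter]
      exact ⟨hy, fun x hx h => hcon x hx h.1 h.2⟩
    have h1 := Finset.card_pos.2 ⟨y, hmem⟩
    have h2 : (1 : ℝ) ≤ ((T.filter fun y => ∀ x ∈ G, ¬ (Disjoint y.1 x ∧ y.2 ⊆ x)).card : ℝ) := by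
      exact_mod_cast h1
    have h3 := h2.trans (le_trans (le_of_eq (by congr)) hGu)
    linarith
  refine ⟨G.image (fun A x => if x ∈ A then 1 else 0), ⟨?_, ?_⟩, ?_⟩
  · intro f hf
    obtain ⟨A, hA, rfl⟩ := Finset.mem_image.1 hf
    have hA2 := (Finset.mem_powersetCard.1 (hG hA)).2
    rw [← hm, ← hA2]
    congr 1
    ext x; simp
  · intro S₀ S₁ hd h0 h1
    obtain ⟨A, hA, hd0, hs⟩ := hcov (S₀, S₁) (by
      rw [hT, Finset.mem_filter, Finset.mem_product, Finset.mem_powersetCard,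
        Finset.mem_powersetCard]
      exact ⟨⟨⟨Finset.subset_univ _, h0⟩, ⟨Finset.subset_univ _, h1⟩⟩, hd⟩)
    refine ⟨_, Finset.mem_image_of_mem _ hA, ?_, ?_⟩
    · intro x hx
      have : x ∉ A := Finset.disjoint_left.1 hd0 hx
      simp [this]
    · rw [one_mul, Nat.ceil_natCast, ← h1]
      congr 1
      apply Finset.filter_true_of_mem
      intro x hx
      simp [hs hx]
  · have hc : ((G.image (fun (A : Finset (Fin n)) (x : Fin n) =>
        if x ∈ A then (1 : Fin 2) else 0)).card : ℝ) ≤ t := by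
      exact_mod_cast Finset.card_image_le.trans hGc
    refine hc.trans ?_
    have hlog2 : Real.log n ≤ Real.logb 2 n := by
      rw [Real.logb, le_div_iff₀ (Real.log_pos (by norm_num))]
      have : Real.log 2 ≤ 1 := by linarith [Real.log_two_lt_d9]
      nlinarith
    have hlb1 : 1 ≤ Real.logb 2 n := by
      rw [Real.le_logb_iff_rpow_le (by norm_num) hnpos]; simpa using hn2R
    have hA1 : 1 ≤ (1 / α) ^ k := by
      apply one_le_pow₀
      rw [le_div_iff₀ hα0]; linarith
    have ht1 : (t : ℝ) ≤ k * Real.log n / p + 1 := by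
      rw [ht]; push_cast
      have := Nat.floor_le (a := k * Real.log n / p) (by positivity)
      linarith
    have ht2 : k * Real.log n / p = (1 / α) ^ k * (2 * k * Real.log n) := by
      rw [hp, one_div, inv_pow]; field_simp
    have hpow : (k : ℝ) ^ 2 ≤ (k : ℝ) ^ (2 * (k : ℝ) ^ ((5 : ℝ) / 6)) := by
      rw [← Real.rpow_natCast]
      apply Real.rpow_le_rpow_of_exponent_le (by linarith)
      have : 1 ≤ (k : ℝ) ^ ((5 : ℝ) / 6) := Real.one_le_rpow (by linarith) (by norm_num)
      push_cast; linarith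
    calc (t : ℝ) ≤ (1 / α) ^ k * (2 * k * Real.log n) + 1 := by rw [← ht2]; exact ht1
      _ ≤ (1 / α) ^ k * (2 * k * Real.logb 2 n) + (1 / α) ^ k * Real.logb 2 n := by
          refine add_le_add ?_ (by nlinarith)
          gcongr
      _ = (1 / α) ^ k * (2 * k + 1) * Real.logb 2 n := by ring
      _ ≤ (1 / α) ^ k * (k : ℝ) ^ (2 * (k : ℝ) ^ ((5 : ℝ) / 6)) * Real.logb 2 n := by
          have : 2 * (k : ℝ) + 1 ≤ (k : ℝ) ^ (2 * (k : ℝ) ^ ((5 : ℝ) / 6)) := by nlinarith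
          gcongr
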